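/- arXiv:2507.01762 — 2 statements merged into one kernel-verified Lean document; each statement's English description precedes it below -/
import Mathlib

section
/- Let τ be a nondegenerate, positively oriented triangle in ℝ² with vertices x0, x1, x2, and set c = 1/|τ| and c_i = 1/(p l_i) + 1/l_i² for i = 0, 1, 2. Then the gradients of the radius ratio μ = p·q/(16|τ|²) with respect to the three vertices are: ∇_{x0}μ = μ[(c1 + c2)x0 − (c2 I − c W)x1 − (c1 I + c W)x2], ∇_{x1}μ = μ[(c2 + c0)x1 − (c0 I − c W)x2 − (c2 I + c W)x0], and ∇_{x2}μ = μ[(c0 + c1)x2 − (c1 I − c W)x0 − (c0 I + c W)x1], where I is the 2×2 identity matrix. -/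
noncomputable section

/-- The Euclidean plane. -/
abbrev E2 := EuclideanSpace ℝ (Fin 2)

/-- Signed area of the triangle `(a, b, c)`: `½ det(b − a, c − a)`. -/
def sarea (a b c : E2) : ℝ :=
  (1/2) * ((b - a) 0 * (c - a) 1 - (b - a) 1 * (c - a) 0)

/-- `R` is the circumradius of the triangle `(a, b, c)`:
the radius of a circle passing through all three vertices. -/
def IsCircumradius2 (a b c : E2) (R : ℝ) : Prop :=
  ∃ z : E2, dist z a = R ∧ dist z b = R ∧ dist z c = R

/-- `r` is the inradius of the triangle `(a, b, c)`: the radius of a circle whose center lies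
in the triangle and which is tangent to (i.e. at distance `r` from) the lines through all
three sides. -/
def IsInradius2 (a b c : E2) (r : ℝ) : Prop :=
  ∃ z : E2, z ∈ convexHull ℝ {a, b, c} ∧
    Metric.infDist z (affineSpan ℝ {b, c} : Set E2) = r ∧
    Metric.infDist z (affineSpan ℝ {c, a} : Set E2) = r ∧
    Metric.infDist z (affineSpan ℝ {a, b} : Set E2) = r

/-- The 90°-rotation matrix `W = ((0, −1), (1, 0))`. -/
def Wmat : Matrix (Fin 2) (Fin 2) ℝ := !![0, -1; 1, 0]

/-- Apply a `2 × 2` real matrix to a vector of `ℝ²`. -/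
def mulVec2 (M : Matrix (Fin 2) (Fin 2) ℝ) (v : E2) : E2 :=
  (WithLp.equiv 2 (Fin 2 → ℝ)).symm (M.mulVec (WithLp.equiv 2 (Fin 2 → ℝ) v))

/-- The radius ratio `μ = R/(2r) = p·q/(16|τ|²)` of the triangle `(a, b, c)`, expressed
through edge lengths and signed area. -/
def ratio2 (a b c : E2) : ℝ :=
  ((‖c - b‖ + ‖a - c‖ + ‖b - a‖) * (‖c - b‖ * ‖a - c‖ * ‖b - a‖)) /
    (16 * (sarea a b c) ^ 2)

theorem mulVec2_sub (M : Matrix (Fin 2) (Fin 2) ℝ) (v w : E2) :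
    mulVec2 M (v - w) = mulVec2 M v - mulVec2 M w := by
  ext i
  simp only [mulVec2, WithLp.equiv_apply, WithLp.equiv_symm_apply, WithLp.ofLp_sub,
    Matrix.mulVec_sub, PiLp.sub_apply, Pi.sub_apply]

theorem sarea_rotate (a b c : E2) : sarea b c a = sarea a b c := by
  simp only [sarea, PiLp.sub_apply]
  ring

theorem ratio2_rotate (a b c : E2) : ratio2 b c a = ratio2 a b c := by
  simp only [ratio2, sarea_rotate]
  ring

theorem hasGradientAt_norm_sub {E : Type*} [NormedAddCommGroup E] [InnerProductSpace ℝ E]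
    [CompleteSpace E] {x a : E} (h : x ≠ a) :
    HasGradientAt (fun y : E => ‖y - a‖) (‖x - a‖⁻¹ • (x - a)) x := by
  have hne : ‖x - a‖ ≠ 0 := norm_ne_zero_iff.2 (sub_ne_zero.2 h)
  have hsq : HasFDerivAt (fun y : E => ‖y - a‖ ^ 2) _ x :=
    ((hasFDerivAt_id x).sub_const a).norm_sq
  have hroot := hsq.sqrt (pow_ne_zero 2 hne)
  simp only [Real.sqrt_sq (norm_nonneg _)] at hroot
  rw [hasGradientAt_iff_hasFDerivAt]
  refine hroot.congr_fderiv ?_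
  ext v
  simp
  field_simp

theorem hasGradientAt_sarea (a b c : E2) :
    HasGradientAt (fun y : E2 => sarea y b c) ((1 / 2 : ℝ) • mulVec2 Wmat (c - b)) a := by
  have h0 (y : E2) : HasFDerivAt (fun y : E2 => y 0) (EuclideanSpace.proj 0 : E2 →L[ℝ] ℝ) y :=
    (EuclideanSpace.proj 0 : E2 →L[ℝ] ℝ).hasFDerivAt
  have h1 (y : E2) : HasFDerivAt (fun y : E2 => y 1) (EuclideanSpace.proj 1 : E2 →L[ℝ] ℝ) y :=
    (EuclideanSpace.proj 1 : E2 →L[ℝ] ℝ).hasFDerivAt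
  rw [hasGradientAt_iff_hasFDerivAt]
  simp only [sarea, PiLp.sub_apply]
  refine (((((h0 a).const_sub (b 0)).mul ((h1 a).const_sub (c 1))).sub
    (((h1 a).const_sub (b 1)).mul ((h0 a).const_sub (c 0)))).const_mul (1 / 2)).congr_fderiv ?_
  ext v
  simp [mulVec2, Wmat, PiLp.inner_apply, Fin.sum_univ_two, dotProduct]
  ring

theorem ne_of_sarea_pos {a b c : E2} (h : 0 < sarea a b c) : a ≠ b := by
  rintro rfl
  simp [sarea] at h

theorem gradient_ratio2_left {a b c : E2} (h : 0 < sarea a b c)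
    {l0 l1 l2 p : ℝ} (hl0 : l0 = ‖c - b‖) (hl1 : l1 = ‖a - c‖) (hl2 : l2 = ‖b - a‖)
    (hp : p = l0 + l1 + l2) :
    gradient (fun y : E2 => ratio2 y b c) a =
      ratio2 a b c • ((1 / (p * l1) + 1 / l1 ^ 2 + (1 / (p * l2) + 1 / l2 ^ 2)) • a -
        ((1 / (p * l2) + 1 / l2 ^ 2) • b - (1 / sarea a b c) • mulVec2 Wmat b) -
        ((1 / (p * l1) + 1 / l1 ^ 2) • c + (1 / sarea a b c) • mulVec2 Wmat c)) := by
  have hab : a ≠ b := ne_of_sarea_pos h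
  have hca : c ≠ a := ne_of_sarea_pos (by rwa [sarea_rotate, sarea_rotate])
  have h1 : 0 < l1 := hl1 ▸ norm_pos_iff.2 (sub_ne_zero.2 hca.symm)
  have h2 : 0 < l2 := hl2 ▸ norm_pos_iff.2 (sub_ne_zero.2 hab.symm)
  have hp0 : 0 < p := by have := hl0 ▸ norm_nonneg (c - b); linarith
  have g1 := (hasGradientAt_norm_sub hca.symm).hasFDerivAt
  have g2 := (hasGradientAt_norm_sub hab).hasFDerivAt
  have gs := (hasGradientAt_sarea a b c).hasFDerivAt
  rw [norm_sub_rev] at hl2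
  apply HasGradientAt.gradient
  rw [hasGradientAt_iff_hasFDerivAt]
  have ginv := (hasDerivAt_inv (show 16 * sarea a b c ^ 2 ≠ 0 by positivity)).comp_hasFDerivAt a
    ((gs.pow 2).const_mul 16)
  simp only [ratio2, norm_sub_rev b]
  refine ((((g1.const_add ‖c - b‖).add g2).mul
    ((g1.const_mul ‖c - b‖).mul g2)).mul ginv).congr_fderiv ?_
  ext v
  simp only [Pi.add_apply, Pi.mul_apply, Function.comp_apply, ← hl0, ← hl1, ← hl2, ← hp,
    InnerProductSpace.toDual_apply_apply, mulVec2_sub, inner_add_left, inner_sub_left,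
    real_inner_smul_left, add_apply, smul_apply, smul_eq_mul]
  field_simp
  ring

/-- For a nondegenerate, positively oriented triangle with vertices `x0, x1, x2` in `ℝ²`,
with `c = 1/|τ|` and `cᵢ = 1/(p lᵢ) + 1/lᵢ²`, the gradients of the radius ratio
`μ = p·q/(16|τ|²)` with respect to the three vertices are
`∇_{x0}μ = μ[(c1 + c2)x0 − (c2 I − c W)x1 − (c1 I + c W)x2]`,
`∇_{x1}μ = μ[(c2 + c0)x1 − (c0 I − c W)x2 − (c2 I + c W)x0]`,
`∇_{x2}μ = μ[(c0 + c1)x2 − (c1 I − c W)x0 − (c0 I + c W)x1]`. -/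
theorem gradient_radius_ratio_all_vertices
    (x0 x1 x2 : E2)
    (hnd : AffineIndependent ℝ ![x0, x1, x2])
    (hpos : 0 < sarea x0 x1 x2)
    (l0 l1 l2 p c c0 c1 c2 μ : ℝ)
    (hl0 : l0 = ‖x2 - x1‖) (hl1 : l1 = ‖x0 - x2‖) (hl2 : l2 = ‖x1 - x0‖)
    (hp : p = l0 + l1 + l2)
    (hc : c = 1 / sarea x0 x1 x2)
    (hc0 : c0 = 1 / (p * l0) + 1 / l0 ^ 2)
    (hc1 : c1 = 1 / (p * l1) + 1 / l1 ^ 2)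
    (hc2 : c2 = 1 / (p * l2) + 1 / l2 ^ 2)
    (hμ : μ = ratio2 x0 x1 x2) :
    gradient (fun y : E2 => ratio2 y x1 x2) x0 =
      μ • ((c1 + c2) • x0 - (c2 • x1 - c • mulVec2 Wmat x1) -
           (c1 • x2 + c • mulVec2 Wmat x2)) ∧
    gradient (fun y : E2 => ratio2 x0 y x2) x1 =
      μ • ((c2 + c0) • x1 - (c0 • x2 - c • mulVec2 Wmat x2) -
           (c2 • x0 + c • mulVec2 Wmat x0)) ∧
    gradient (fun y : E2 => ratio2 x0 x1 y) x2 =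
      μ • ((c0 + c1) • x2 - (c1 • x0 - c • mulVec2 Wmat x0) -
           (c0 • x1 + c • mulVec2 Wmat x1)) := by
  have hpos' : 0 < sarea x1 x2 x0 := by rwa [sarea_rotate]
  have hpos'' : 0 < sarea x2 x0 x1 := by rwa [sarea_rotate]
  subst hc hc0 hc1 hc2 hμ
  refine ⟨gradient_ratio2_left hpos hl0 hl1 hl2 hp, ?_, ?_⟩
  · simp only [← ratio2_rotate x0, ← sarea_rotate x0]
    exact gradient_ratio2_left hpos' hl1 hl2 hl0 (by linarith)
  · simp only [ratio2_rotate _ x0 x1, sarea_rotate _ x0 x1]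
    exact gradient_ratio2_left hpos'' hl2 hl0 hl1 (by linarith)
end
end

section
/- Let x0, x1, x2, x3 ∈ ℝ³ be the vertices of a nondegenerate tetrahedron, and regard the total surface area s = s0 + s1 + s2 + s3 (s_i being the area of the face opposite x_i) as a function of x0 with x1, x2, x3 fixed. Then ∇_{x0} s = ( v31·v30/(4s2) + v21·v20/(4s3) ) v10 + ( v32·v30/(4s1) + v12·v10/(4s3) ) v20 + ( v23·v20/(4s1) + v13·v10/(4s2) ) v30. -/
noncomputable section

/-- Euclidean three-space. -/
abbrev E3 := EuclideanSpace ℝ (Fin 3)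

/-- The cross product on `ℝ³`. -/
def cross (a b : E3) : E3 :=
  (WithLp.equiv 2 (Fin 3 → ℝ)).symm
    ![a 1 * b 2 - a 2 * b 1, a 2 * b 0 - a 0 * b 2, a 0 * b 1 - a 1 * b 0]

/-- The dot product on `ℝ³`. -/
def dot (a b : E3) : ℝ := a 0 * b 0 + a 1 * b 1 + a 2 * b 2

/-- Signed volume of the tetrahedron `(a, b, c, d)`:
`(1/6) det(b − a, c − a, d − a)`. -/
def svol (a b c d : E3) : ℝ := (1/6) * dot (b - a) (cross (c - a) (d - a))

/-- Area of the triangle `(a, b, c)` in `ℝ³`. -/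
def triArea (a b c : E3) : ℝ := (1/2) * ‖cross (b - a) (c - a)‖

/-- Total surface area of the tetrahedron `(a, b, c, d)`: the sum of the areas of the four
triangular faces (the face opposite each vertex). -/
def sTot (a b c d : E3) : ℝ :=
  triArea b c d + triArea a c d + triArea a b d + triArea a b c

/-- The vector `d0 = ‖v30‖²(v10 × v20) + ‖v10‖²(v20 × v30) + ‖v20‖²(v30 × v10)` of the
tetrahedron `(a, b, c, d)`, where `v10 = a − b`, `v20 = a − c`, `v30 = a − d`. -/
def d0vec (a b c d : E3) : E3 :=
  ‖a - d‖ ^ 2 • cross (a - b) (a - c) + ‖a - b‖ ^ 2 • cross (a - c) (a - d) +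
    ‖a - c‖ ^ 2 • cross (a - d) (a - b)

/-- `R` is the circumradius of the tetrahedron `(a, b, c, d)`: the radius of a sphere
through the four vertices. -/
def IsCircumradius3 (a b c d : E3) (R : ℝ) : Prop :=
  ∃ z : E3, dist z a = R ∧ dist z b = R ∧ dist z c = R ∧ dist z d = R

/-- `r` is the inradius of the tetrahedron `(a, b, c, d)`: the radius of a sphere whose
center lies in the tetrahedron and which is tangent to (i.e. at distance `r` from) the
planes of all four faces. -/
def IsInradius3 (a b c d : E3) (r : ℝ) : Prop :=
  ∃ z : E3, z ∈ convexHull ℝ {a, b, c, d} ∧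
    Metric.infDist z (affineSpan ℝ {b, c, d} : Set E3) = r ∧
    Metric.infDist z (affineSpan ℝ {a, c, d} : Set E3) = r ∧
    Metric.infDist z (affineSpan ℝ {a, b, d} : Set E3) = r ∧
    Metric.infDist z (affineSpan ℝ {a, b, c} : Set E3) = r

theorem dot_eq_inner (u w : E3) : dot u w = inner ℝ u w := by
  simp [dot, PiLp.inner_apply, Fin.sum_univ_three, mul_comm]

theorem norm_cross (u w : E3) :
    ‖cross u w‖ = √(‖u‖ ^ 2 * ‖w‖ ^ 2 - inner ℝ u w ^ 2) := by
  rw [← dot_eq_inner, EuclideanSpace.real_norm_sq_eq, EuclideanSpace.real_norm_sq_eq,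
    EuclideanSpace.norm_eq]
  congr 1
  simp [cross, dot, Fin.sum_univ_three]
  ring

theorem triArea_eq (x b c : E3) :
    triArea x b c =
      1 / 2 * √(‖x - b‖ ^ 2 * ‖x - c‖ ^ 2 - inner ℝ (x - b) (x - c) ^ 2) := by
  rw [triArea, norm_cross, norm_sub_rev b, norm_sub_rev c, ← neg_sub x b, ← neg_sub x c,
    inner_neg_neg]

theorem triArea_ne_zero {x b c : E3} (h : AffineIndependent ℝ ![x, b, c]) :
    triArea x b c ≠ 0 := by
  have hli : LinearIndependent ℝ ![b - x, c - x] := by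
    have h' := (affineIndependent_iff_linearIndependent_vsub ℝ _ (0 : Fin 3)).1 h
    have h'' := h'.comp (fun i : Fin 2 => ⟨i.succ, Fin.succ_ne_zero i⟩)
      (fun i j hij => by simpa using hij)
    have hfun : ![b - x, c - x] = (fun i : { i : Fin 3 // i ≠ 0 } =>
        ![x, b, c] i -ᵥ ![x, b, c] 0) ∘ fun i : Fin 2 => ⟨i.succ, Fin.succ_ne_zero i⟩ := by
      ext i : 1
      fin_cases i <;> simp
    rw [hfun]
    exact h''
  have hcross : cross (b - x) (c - x) ≠ 0 := by
    intro h0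
    have hofLp : LinearIndependent ℝ ![(b - x).ofLp, (c - x).ofLp] := by
      have := hli.map' (WithLp.linearEquiv 2 ℝ (Fin 3 → ℝ)).toLinearMap (LinearEquiv.ker _)
      have hfun : ![(b - x).ofLp, (c - x).ofLp] =
          WithLp.linearEquiv 2 ℝ (Fin 3 → ℝ) ∘ ![b - x, c - x] := by
        ext i : 1
        fin_cases i <;> simp
      rw [hfun]
      exact this
    refine crossProduct_ne_zero_iff_linearIndependent.2 hofLp ?_
    rw [cross_apply]
    simpa [cross] using h0
  simpa [triArea] using hcross

theorem hasGradientAt_triArea {x b c : E3} (h : triArea x b c ≠ 0) :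
    HasGradientAt (fun y => triArea y b c)
      ((dot (b - c) (x - c) / (4 * triArea x b c)) • (x - b) +
        (dot (c - b) (x - b) / (4 * triArea x b c)) • (x - c)) x := by
  have hb : HasFDerivAt (fun y : E3 => y - b) (ContinuousLinearMap.id ℝ E3) x :=
    (hasFDerivAt_id x).sub_const b
  have hc : HasFDerivAt (fun y : E3 => y - c) (ContinuousLinearMap.id ℝ E3) x :=
    (hasFDerivAt_id x).sub_const c
  simp only [triArea_eq] at h
  have hQ : ‖x - b‖ ^ 2 * ‖x - c‖ ^ 2 - inner ℝ (x - b) (x - c) ^ 2 ≠ 0 := by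
    rintro hQ
    simp [hQ] at h
  have hs := (((hb.norm_sq.mul hc.norm_sq).sub ((hb.inner ℝ hc).pow 2)).sqrt hQ).const_mul (1 / 2)
  rw [hasGradientAt_iff_hasFDerivAt]
  simp only [triArea_eq]
  refine hs.congr_fderiv ?_
  ext v
  rw [← sub_sub_sub_cancel_left c b x, ← sub_sub_sub_cancel_left b c x]
  have hr : √(‖x - b‖ ^ 2 * ‖x - c‖ ^ 2 - inner ℝ (x - b) (x - c) ^ 2) ≠ 0 := by
    intro h0
    simp [h0] at h
  clear hs h hQ hb hc
  generalize √(‖x - b‖ ^ 2 * ‖x - c‖ ^ 2 - inner ℝ (x - b) (x - c) ^ 2) = r at hr ⊢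
  generalize x - b = u
  generalize x - c = w
  simp [dot_eq_inner, inner_sub_left, fderivInnerCLM_apply]
  rw [real_inner_comm u w, real_inner_comm w v]
  field_simp
  ring

/-- For a nondegenerate tetrahedron with vertices `x0, x1, x2, x3` in `ℝ³`, the gradient of
the total surface area `s = s0 + s1 + s2 + s3`, regarded as a function of `x0`, is
`∇_{x0} s = (v31·v30/(4s2) + v21·v20/(4s3)) v10 + (v32·v30/(4s1) + v12·v10/(4s3)) v20
          + (v23·v20/(4s1) + v13·v10/(4s2)) v30`. -/
theorem gradient_surface_area
    (x0 x1 x2 x3 : E3)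
    (hnd : AffineIndependent ℝ ![x0, x1, x2, x3])
    (s1 s2 s3 : ℝ)
    (hs1 : s1 = triArea x0 x2 x3) (hs2 : s2 = triArea x0 x1 x3)
    (hs3 : s3 = triArea x0 x1 x2) :
    gradient (fun x : E3 => sTot x x1 x2 x3) x0 =
      (dot (x1 - x3) (x0 - x3) / (4 * s2) + dot (x1 - x2) (x0 - x2) / (4 * s3)) •
          (x0 - x1) +
        (dot (x2 - x3) (x0 - x3) / (4 * s1) + dot (x2 - x1) (x0 - x1) / (4 * s3)) •
          (x0 - x2) +
        (dot (x3 - x2) (x0 - x2) / (4 * s1) + dot (x3 - x1) (x0 - x1) / (4 * s2)) •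
          (x0 - x3) := by
  have h1 : triArea x0 x2 x3 ≠ 0 := triArea_ne_zero <| by
    convert hnd.comp_embedding ⟨![0, 2, 3], by decide⟩ using 1
    ext i : 1
    fin_cases i <;> rfl
  have h2 : triArea x0 x1 x3 ≠ 0 := triArea_ne_zero <| by
    convert hnd.comp_embedding ⟨![0, 1, 3], by decide⟩ using 1
    ext i : 1
    fin_cases i <;> rfl
  have h3 : triArea x0 x1 x2 ≠ 0 := triArea_ne_zero <| by
    convert hnd.comp_embedding ⟨![0, 1, 2], by decide⟩ using 1
    ext i : 1
    fin_cases i <;> rfl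
  subst hs1 hs2 hs3
  have hsum := (((hasFDerivAt_const (triArea x1 x2 x3) x0).add
    (hasGradientAt_triArea h1).hasFDerivAt).add
    (hasGradientAt_triArea h2).hasFDerivAt).add (hasGradientAt_triArea h3).hasFDerivAt
  rw [zero_add, ← map_add, ← map_add, ← hasGradientAt_iff_hasFDerivAt] at hsum
  refine (HasGradientAt.gradient hsum).trans ?_
  module
end
end
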